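/- Cauchy transform of the semicircle law: Let ν be the Borel probability measure on ℝ with density q(t) = (1/(2π))√(4 − t²) on [−2, 2] and let G be its Cauchy transform. Then for every z ∈ ℂ⁺, G(z)² − z·G(z) + 1 = 0; equivalently G(z) = (z − √(z² − 4))/2 where the square root is the branch making Im G(z) < 0. -/

import Mathlib

open MeasureTheory

/-- The Cauchy transform `G_ν(z) = ∫_ℝ 1/(z − t) dν(t)` of a Borel measure `ν`
on `ℝ`, defined for `z` in the upper half-plane. -/
noncomputable def cauchyTransform (ν : Measure ℝ) (z : ℂ) : ℂ :=
  ∫ t, (z - (t : ℂ))⁻¹ ∂ν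

/-- The standard semicircle law: the measure on `ℝ` with density
`q(t) = (1/(2π))√(4 − t²)` on `[−2, 2]` and `0` elsewhere. -/
noncomputable def semicircleMeasure : Measure ℝ :=
  volume.withDensity fun t =>
    ENNReal.ofReal (if |t| ≤ 2 then Real.sqrt (4 - t ^ 2) / (2 * Real.pi) else 0)

/-- Every `z` in the upper half-plane is `w + w⁻¹` for some `w` in the lower half of the
open unit disc. -/
theorem exists_add_inv_eq_of_im_pos {z : ℂ} (hz : 0 < z.im) :
    ∃ w : ℂ, w ≠ 0 ∧ ‖w‖ < 1 ∧ w.im < 0 ∧ z = w + w⁻¹ := by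
  obtain ⟨s, hs⟩ := IsAlgClosed.exists_pow_nat_eq (z ^ 2 - 4) (n := 2) two_pos
  have key : ∀ w : ℂ, w ≠ 0 → ‖w‖ ≤ 1 → z = w + w⁻¹ →
      ∃ w : ℂ, w ≠ 0 ∧ ‖w‖ < 1 ∧ w.im < 0 ∧ z = w + w⁻¹ := by
    intro w h0 h1 h
    have hpos : 0 < Complex.normSq w := Complex.normSq_pos.2 h0
    have hle : Complex.normSq w ≤ 1 := by
      rw [Complex.normSq_eq_norm_sq]
      exact pow_le_one₀ (norm_nonneg w) h1
    have him : z.im * Complex.normSq w = w.im * (Complex.normSq w - 1) := by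
      rw [h, Complex.add_im, Complex.inv_im]
      field_simp
      ring
    have hprod : 0 < w.im * (Complex.normSq w - 1) := him ▸ mul_pos hz hpos
    have hlt : Complex.normSq w < 1 := by
      refine lt_of_le_of_ne hle fun he => ?_
      simp [he] at hprod
    refine ⟨w, h0, ?_, ?_, h⟩
    · rw [Complex.normSq_eq_norm_sq] at hlt
      exact (sq_lt_one_iff₀ (norm_nonneg w)).1 hlt
    · nlinarith
  have hmul : (z - s) / 2 * ((z + s) / 2) = 1 := by linear_combination -hs / 4
  have hinv : ((z - s) / 2)⁻¹ = (z + s) / 2 := inv_eq_of_mul_eq_one_right hmul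
  have h0 : (z - s) / 2 ≠ 0 := left_ne_zero_of_mul_eq_one hmul
  rcases le_total ‖(z - s) / 2‖ 1 with h | h
  · exact key _ h0 h (by rw [hinv]; ring)
  · refine key ((z - s) / 2)⁻¹ (inv_ne_zero h0) ?_ (by rw [inv_inv, hinv]; ring)
    rw [norm_inv]
    exact inv_le_one_of_one_le₀ h

theorem sub_two_mul_cos_ne_zero {z : ℂ} (hz : 0 < z.im) (θ : ℝ) :
    z - 2 * (Real.cos θ : ℂ) ≠ 0 := by
  intro h
  have := congrArg Complex.im h
  simp [Complex.mul_im, -Complex.ofReal_cos] at this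
  exact hz.ne' this

theorem integral_inv_add_inv_sub_two_mul_cos {w : ℂ} (h0 : w ≠ 0) (h1 : ‖w‖ < 1) :
    ∫ θ in (0 : ℝ)..2 * Real.pi, (w + w⁻¹ - 2 * (Real.cos θ : ℂ))⁻¹ =
      2 * Real.pi * (w / (1 - w ^ 2)) := by
  have hne : ∀ ζ : ℂ, ‖ζ‖ ≤ 1 → 1 - w * ζ ≠ 0 := by
    intro ζ hζ h
    have h2 : ‖w * ζ‖ < 1 := by
      rw [norm_mul]
      exact (mul_le_of_le_one_right (norm_nonneg w) hζ).trans_lt h1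
    rw [← sub_eq_zero.1 h] at h2
    simp at h2
  have hd : DifferentiableOn ℂ (fun ζ => w / (1 - w * ζ)) (Metric.closedBall 0 1) := by
    intro ζ hζ
    refine DifferentiableAt.differentiableWithinAt ?_
    have := hne ζ (by simpa using hζ)
    fun_prop (disch := assumption)
  have hc := hd.circleIntegral_sub_inv_smul (w := w) (by simpa using h1)
  rw [circleIntegral] at hc
  have hcongr : ∀ θ : ℝ, deriv (circleMap 0 1) θ •
      ((circleMap 0 1 θ - w)⁻¹ • (w / (1 - w * circleMap 0 1 θ))) =
      Complex.I * (w + w⁻¹ - 2 * (Real.cos θ : ℂ))⁻¹ := by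
    intro θ
    have hζ : ‖circleMap 0 1 θ‖ = 1 := by simp
    have hcos : 2 * (Real.cos θ : ℂ) = circleMap 0 1 θ + (circleMap 0 1 θ)⁻¹ := by
      simp [circleMap, Complex.cos, ← Complex.exp_neg]
      ring
    rw [deriv_circleMap, hcos]
    generalize circleMap 0 1 θ = ζ at hζ
    have hζ0 : ζ ≠ 0 := by
      rintro rfl
      simp at hζ
    have ha : 1 - w * ζ ≠ 0 := hne ζ hζ.le
    have hb : ζ - w ≠ 0 := by
      intro h
      rw [sub_eq_zero.1 h] at hζ
      exact h1.ne hζ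
    have hfac : w + w⁻¹ - (ζ + ζ⁻¹) = (1 - w * ζ) * (ζ - w) / (w * ζ) := by
      field_simp
      ring
    rw [hfac]
    simp only [smul_eq_mul]
    field_simp
  simp only [hcongr] at hc
  rw [intervalIntegral.integral_const_mul, smul_eq_mul] at hc
  refine mul_left_cancel₀ Complex.I_ne_zero (hc.trans ?_)
  ring

theorem integral_sq_sin_div_sub_two_mul_cos {w : ℂ} (h0 : w ≠ 0) (h1 : ‖w‖ < 1)
    (hz : 0 < (w + w⁻¹).im) :
    ∫ θ in (0 : ℝ)..2 * Real.pi,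
      4 * (Real.sin θ : ℂ) ^ 2 * (w + w⁻¹ - 2 * (Real.cos θ : ℂ))⁻¹ = 4 * Real.pi * w := by
  have hw : 1 - w ^ 2 ≠ 0 := by
    intro h
    have h2 := congrArg norm (sub_eq_zero.1 h)
    rw [norm_one, norm_pow] at h2
    exact ((sq_lt_one_iff₀ (norm_nonneg w)).2 h1).ne h2.symm
  have hcongr : ∀ θ : ℝ, 4 * (Real.sin θ : ℂ) ^ 2 * (w + w⁻¹ - 2 * (Real.cos θ : ℂ))⁻¹ =
      (4 - (w + w⁻¹) ^ 2) * (w + w⁻¹ - 2 * (Real.cos θ : ℂ))⁻¹ +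
        (w + w⁻¹ + 2 * (Real.cos θ : ℂ)) := by
    intro θ
    have hne := sub_two_mul_cos_ne_zero hz θ
    have hs : (Real.sin θ : ℂ) ^ 2 = 1 - (Real.cos θ : ℂ) ^ 2 := by
      rw [← Complex.ofReal_pow, Real.sin_sq]
      push_cast
      rfl
    rw [hs]
    linear_combination (w + w⁻¹ + 2 * (Real.cos θ : ℂ)) * mul_inv_cancel₀ hne
  have hcont : Continuous fun θ : ℝ => (w + w⁻¹ - 2 * (Real.cos θ : ℂ))⁻¹ :=
    Continuous.inv₀ (by fun_prop) (sub_two_mul_cos_ne_zero hz)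
  have hcos : ∫ θ in (0 : ℝ)..2 * Real.pi, (Real.cos θ : ℂ) = 0 := by
    rw [intervalIntegral.integral_ofReal, integral_cos]
    simp
  simp only [hcongr]
  rw [intervalIntegral.integral_add ((hcont.const_mul _).intervalIntegrable _ _)
      (Continuous.intervalIntegrable (by fun_prop) _ _),
    intervalIntegral.integral_add (by simp) (Continuous.intervalIntegrable (by fun_prop) _ _),
    intervalIntegral.integral_const_mul, intervalIntegral.integral_const_mul, hcos,
    integral_inv_add_inv_sub_two_mul_cos h0 h1, intervalIntegral.integral_const]
  simp only [sub_zero, Complex.real_smul, mul_zero, add_zero]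
  push_cast
  field_simp
  ring

theorem cauchyTransform_semicircleMeasure_eq_integral (z : ℂ) :
    cauchyTransform semicircleMeasure z =
      (2 * Real.pi : ℂ)⁻¹ * ∫ t in (-2 : ℝ)..2, (Real.sqrt (4 - t ^ 2) : ℂ) * (z - t)⁻¹ := by
  have hdens : ∀ t : ℝ, (if |t| ≤ 2 then Real.sqrt (4 - t ^ 2) / (2 * Real.pi) else 0) =
      Real.sqrt (4 - t ^ 2) / (2 * Real.pi) := by
    intro t
    split_ifs with h
    · rfl
    · rw [Real.sqrt_eq_zero_of_nonpos, zero_div]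
      nlinarith [sq_abs t, abs_nonneg t]
  rw [cauchyTransform, semicircleMeasure]
  simp only [hdens]
  rw [integral_withDensity_eq_integral_toReal_smul (by fun_prop) (by simp),
    intervalIntegral.integral_of_le (by norm_num), ← integral_Icc_eq_integral_Ioc,
    setIntegral_eq_integral_of_forall_compl_eq_zero, ← integral_const_mul]
  · refine integral_congr_ae (.of_forall fun t => ?_)
    simp only
    rw [ENNReal.toReal_ofReal (by positivity), Complex.real_smul]
    push_cast
    ring
  · intro t ht
    have h : 2 < |t| := by
      by_contra! h
      exact ht (abs_le.1 h)
    rw [Real.sqrt_eq_zero_of_nonpos, Complex.ofReal_zero, zero_mul]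
    nlinarith [sq_abs t, abs_nonneg t]

theorem integral_sqrt_mul_inv_sub_eq {z : ℂ} (hz : 0 < z.im) :
    ∫ t in (-2 : ℝ)..2, (Real.sqrt (4 - t ^ 2) : ℂ) * (z - t)⁻¹ =
      ∫ θ in (0 : ℝ)..Real.pi, 4 * (Real.sin θ : ℂ) ^ 2 * (z - 2 * (Real.cos θ : ℂ))⁻¹ := by
  have hcont : Continuous fun t : ℝ => (Real.sqrt (4 - t ^ 2) : ℂ) * (z - t)⁻¹ := by
    refine Continuous.mul (by fun_prop) (Continuous.inv₀ (by fun_prop) fun t h => hz.ne' ?_)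
    simpa using congrArg Complex.im h
  have hsub := intervalIntegral.integral_deriv_smul_comp (a := 0) (b := Real.pi)
    (f := fun θ => 2 * Real.cos θ) (f' := fun θ => 2 * -Real.sin θ)
    (fun θ _ => (Real.hasDerivAt_cos θ).const_mul 2) (by fun_prop) hcont
  rw [Real.cos_zero, Real.cos_pi, mul_one, mul_neg_one] at hsub
  rw [intervalIntegral.integral_symm, ← hsub, ← intervalIntegral.integral_neg]
  refine intervalIntegral.integral_congr fun θ hθ => ?_
  rw [Set.uIcc_of_le Real.pi_pos.le] at hθ
  have hsin := Real.sin_nonneg_of_mem_Icc hθ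
  have hsqrt : Real.sqrt (4 - (2 * Real.cos θ) ^ 2) = 2 * Real.sin θ := by
    rw [← Real.sqrt_sq (by positivity : 0 ≤ 2 * Real.sin θ)]
    congr 1
    linear_combination -4 * Real.sin_sq_add_cos_sq θ
  simp only [Function.comp_apply, hsqrt, Complex.real_smul]
  push_cast
  ring

theorem two_mul_integral_sq_sin_div_sub_two_mul_cos {z : ℂ} (hz : 0 < z.im) :
    2 * ∫ θ in (0 : ℝ)..Real.pi, 4 * (Real.sin θ : ℂ) ^ 2 * (z - 2 * (Real.cos θ : ℂ))⁻¹ =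
      ∫ θ in (0 : ℝ)..2 * Real.pi,
        4 * (Real.sin θ : ℂ) ^ 2 * (z - 2 * (Real.cos θ : ℂ))⁻¹ := by
  have hcont : Continuous fun θ : ℝ =>
      4 * (Real.sin θ : ℂ) ^ 2 * (z - 2 * (Real.cos θ : ℂ))⁻¹ :=
    Continuous.mul (by fun_prop) (Continuous.inv₀ (by fun_prop) (sub_two_mul_cos_ne_zero hz))
  have hrefl := intervalIntegral.integral_comp_sub_left (a := 0) (b := Real.pi)
    (fun θ : ℝ => 4 * (Real.sin θ : ℂ) ^ 2 * (z - 2 * (Real.cos θ : ℂ))⁻¹) (2 * Real.pi)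
  simp only [Real.sin_two_pi_sub, Real.cos_two_pi_sub, Complex.ofReal_neg, neg_sq, sub_zero,
    show 2 * Real.pi - Real.pi = Real.pi by ring] at hrefl
  rw [← intervalIntegral.integral_add_adjacent_intervals (a := 0) (b := Real.pi)
    (c := 2 * Real.pi) (hcont.intervalIntegrable _ _) (hcont.intervalIntegrable _ _), ← hrefl, two_mul]

/-- Cauchy transform of the semicircle law.  For every `z` in the
upper half-plane, `G(z)² − z·G(z) + 1 = 0`; equivalently
`G(z) = (z − √(z² − 4))/2` for the branch of the square root making
`Im G(z) < 0`. -/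
theorem semicircle_cauchyTransform (z : ℂ) (hz : 0 < z.im) :
    (cauchyTransform semicircleMeasure z) ^ 2
        - z * cauchyTransform semicircleMeasure z + 1 = 0 ∧
    (cauchyTransform semicircleMeasure z).im < 0 := by
  obtain ⟨w, h0, h1, him, rfl⟩ := exists_add_inv_eq_of_im_pos hz
  have hG : cauchyTransform semicircleMeasure (w + w⁻¹) = w := by
    have hint := two_mul_integral_sq_sin_div_sub_two_mul_cos hz
    rw [integral_sq_sin_div_sub_two_mul_cos h0 h1 hz] at hint
    rw [cauchyTransform_semicircleMeasure_eq_integral, integral_sqrt_mul_inv_sub_eq hz,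
      inv_mul_eq_iff_eq_mul₀ (by simp [Real.pi_ne_zero])]
    linear_combination hint / 2
  rw [hG]
  refine ⟨?_, him⟩
  field_simp
  ring
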